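/- Let X = ℝ with the Euclidean metric. Then for every uniform equivalence f of ℝ, every weak topologically stable point of f is a shadowable point of f, and every shadowable point of f is an α-persistent point of f; that is, Wts(f) ⊆ Sh(f) ⊆ P_α(f). -/

import Mathlib

/-- `g` is a uniform equivalence: both `g` and `g⁻¹` are uniformly continuous. -/
def IsUniformEquiv (g : Equiv.Perm ℝ) : Prop :=
  UniformContinuous g ∧ UniformContinuous g.symm

/-- The `C⁰`-distance `D(f,g) = sup_x min(d(f x, g x), 1)`. -/
noncomputable def C0Dist (f g : ℝ → ℝ) : ℝ :=
  ⨆ x : ℝ, min (dist (f x) (g x)) 1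

/-- The closure of the full `g`-orbit of `x`. -/
def OrbitClosure (g : Equiv.Perm ℝ) (x : ℝ) : Set ℝ :=
  closure (Set.range fun n : ℤ => (g ^ n) x)

/-- `x` is a weak topologically stable point of `f`. -/
def IsWeakTopStablePt (f : Equiv.Perm ℝ) (x : ℝ) : Prop :=
  ∀ ε : ℝ, 0 < ε → ∃ δ : ℝ, 0 < δ ∧
    ∀ g : Equiv.Perm ℝ, IsUniformEquiv g → C0Dist f g < δ →
      ∃ h : OrbitClosure g x → ℝ, Continuous h ∧
        (∀ (y : OrbitClosure g x) (n : ℤ),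
          dist ((f ^ n) (h y)) ((g ^ n) (y : ℝ)) < ε) ∧
        (∀ y : OrbitClosure g x, dist (h y) (y : ℝ) < ε)

/-- `x` is a shadowable point of `f`. -/
def IsShadowablePt (f : Equiv.Perm ℝ) (x : ℝ) : Prop :=
  ∀ ε : ℝ, 0 < ε → ∃ δ : ℝ, 0 < δ ∧ ∀ ρ : ℤ → ℝ, ρ 0 = x →
    (∀ i : ℤ, dist (f (ρ i)) (ρ (i + 1)) < δ) →
    ∃ y : ℝ, ∀ i : ℤ, dist ((f ^ i) y) (ρ i) < ε

/-- `x` is an `α`-persistent point of `f`. -/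
def IsAlphaPersistentPt (f : Equiv.Perm ℝ) (x : ℝ) : Prop :=
  ∀ ε : ℝ, 0 < ε → ∃ δ : ℝ, 0 < δ ∧
    ∀ g : Equiv.Perm ℝ, IsUniformEquiv g → C0Dist f g < δ →
      ∃ y : ℝ, ∀ n : ℤ, dist ((f ^ n) y) ((g ^ n) x) < ε

namespace WtsAux

lemma uc_le {f : ℝ → ℝ} (h : UniformContinuous f) {ε : ℝ} (hε : 0 < ε) :
    ∃ δ : ℝ, 0 < δ ∧ ∀ s t, |s - t| ≤ δ → |f s - f t| ≤ ε := by
  obtain ⟨δ, hδ, H⟩ := Metric.uniformContinuous_iff.1 h ε hε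
  refine ⟨δ / 2, by linarith, fun s t hst => ?_⟩
  have := H (a := s) (b := t) (by rw [Real.dist_eq]; linarith)
  rw [Real.dist_eq] at this
  exact this.le

lemma zpow_succ_apply (F : Equiv.Perm ℝ) (k : ℤ) (t : ℝ) : (F ^ (k + 1)) t = F ((F ^ k) t) := by
  rw [add_comm, zpow_add, zpow_one]; rfl

lemma zpow_succ_apply' (F : Equiv.Perm ℝ) (k : ℤ) (t : ℝ) : (F ^ (k + 1)) t = (F ^ k) (F t) := by
  rw [zpow_add, zpow_one]; rfl

lemma strictMono_symm {F : Equiv.Perm ℝ} (h : StrictMono F) : StrictMono F.symm := by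
  intro a b hab
  by_contra hc
  have := h.monotone (not_lt.1 hc)
  simp at this
  linarith

lemma strictMono_pow {F : Equiv.Perm ℝ} (h : StrictMono F) (n : ℕ) : StrictMono (F ^ n) := by
  rw [Equiv.Perm.coe_pow]; exact h.iterate n

lemma strictMono_zpow {F : Equiv.Perm ℝ} (h : StrictMono F) (k : ℤ) : StrictMono (F ^ k) := by
  cases k with
  | ofNat n => simpa using strictMono_pow h n
  | negSucc n =>
    rw [zpow_negSucc, ← inv_pow]
    exact strictMono_pow (F := F⁻¹) (strictMono_symm h) _

lemma orbit_mono {F : Equiv.Perm ℝ} (h : StrictMono F) {x : ℝ} (hx : x ≤ F x) :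
    Monotone fun k : ℤ => (F ^ k) x := by
  apply monotone_int_of_le_succ
  intro k
  rw [zpow_succ_apply']
  exact (strictMono_zpow h k).monotone hx

lemma orbit_anti {F : Equiv.Perm ℝ} (h : StrictMono F) {x : ℝ} (hx : F x ≤ x) :
    Antitone fun k : ℤ => (F ^ k) x := by
  apply antitone_int_of_succ_le
  intro k
  rw [zpow_succ_apply']
  exact (strictMono_zpow h k).monotone hx

lemma continuous_pow' {F : Equiv.Perm ℝ} (h : Continuous F) (n : ℕ) : Continuous (F ^ n) := by
  rw [Equiv.Perm.coe_pow]; exact h.iterate n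

lemma continuous_zpow' {F : Equiv.Perm ℝ} (h : Continuous F) (h' : Continuous F.symm) (k : ℤ) :
    Continuous (F ^ k) := by
  cases k with
  | ofNat n => simpa using continuous_pow' h n
  | negSucc n =>
    rw [zpow_negSucc, ← inv_pow]
    exact continuous_pow' (F := F⁻¹) h' _

structure Good (F : Equiv.Perm ℝ) (S : Set ℝ) : Prop where
  mono : StrictMono F
  uc : UniformContinuous F
  uc' : UniformContinuous F.symm
  oc : S.OrdConnected
  inv : ∀ p, F p ∈ S ↔ p ∈ S

def PO (F : Equiv.Perm ℝ) (δ : ℝ) (w : ℤ → ℝ) : Prop := ∀ i, |F (w i) - w (i + 1)| ≤ δ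

def Mon (F : Equiv.Perm ℝ) (S : Set ℝ) (x : ℝ) : Prop :=
  ∀ ε : ℝ, 0 < ε → ∃ δ : ℝ, 0 < δ ∧ ∀ w : ℤ → ℝ, (Monotone w ∨ Antitone w) → w 0 = x →
    (∀ i, w i ∈ S) → PO F δ w → ∃ y, ∀ i, |(F ^ i) y - w i| ≤ ε

def mir (F : Equiv.Perm ℝ) : Equiv.Perm ℝ := Equiv.neg ℝ * F * (Equiv.neg ℝ)⁻¹

lemma mir_apply (F : Equiv.Perm ℝ) (t : ℝ) : mir F t = - F (-t) := rfl
lemma mir_symm_apply (F : Equiv.Perm ℝ) (t : ℝ) : (mir F).symm t = - F.symm (-t) := rfl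

lemma mir_zpow (F : Equiv.Perm ℝ) (k : ℤ) (t : ℝ) : ((mir F) ^ k) t = - (F ^ k) (-t) := by
  rw [mir, conj_zpow]; rfl

lemma Good.inverse {F : Equiv.Perm ℝ} {S : Set ℝ} (h : Good F S) : Good F⁻¹ S where
  mono := strictMono_symm h.mono
  uc := h.uc'
  uc' := h.uc
  oc := h.oc
  inv p := by rw [← h.inv (F⁻¹ p)]; simp

lemma uc_neg {f : ℝ → ℝ} (h : UniformContinuous f) : UniformContinuous fun t => - f (-t) :=
  (h.comp uniformContinuous_neg).neg

lemma Good.mirror {F : Equiv.Perm ℝ} {S : Set ℝ} (h : Good F S) :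
    Good (mir F) {p | -p ∈ S} where
  mono a b hab := by
    rw [mir_apply, mir_apply]
    exact neg_lt_neg (h.mono (neg_lt_neg hab))
  uc := uc_neg h.uc
  uc' := uc_neg h.uc'
  oc := ⟨fun a ha b hb c hc => h.oc.out hb ha ⟨neg_le_neg hc.2, neg_le_neg hc.1⟩⟩
  inv p := by
    have := h.inv (-p)
    simpa [mir_apply] using this

lemma Mon.mirror {F : Equiv.Perm ℝ} {S : Set ℝ} {x : ℝ} (h : Mon F S x) :
    Mon (mir F) {p | -p ∈ S} (-x) := by
  intro ε hε
  obtain ⟨δ, hδ, H⟩ := h ε hε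
  refine ⟨δ, hδ, fun w hw h0 hS hP => ?_⟩
  have hw' : Monotone (fun i => - w i) ∨ Antitone (fun i => - w i) := by
    rcases hw with hw | hw
    · exact Or.inr hw.neg
    · exact Or.inl hw.neg
  have hP' : PO F δ (fun i => - w i) := by
    intro i
    have := hP i
    rw [mir_apply, ← abs_neg] at this
    convert this using 2
    ring
  obtain ⟨y, hy⟩ := H (fun i => - w i) hw' (by simp [h0]) hS hP'
  refine ⟨-y, fun i => ?_⟩
  rw [mir_zpow, neg_neg]
  have := hy i
  rw [← abs_neg]
  convert this using 2
  ring

lemma Mon.inverse {F : Equiv.Perm ℝ} {S : Set ℝ} {x : ℝ} (g : Good F S) (h : Mon F S x) :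
    Mon F⁻¹ S x := by
  intro ε hε
  obtain ⟨δ, hδ, H⟩ := h ε hε
  obtain ⟨δ', hδ', H'⟩ := uc_le g.uc hδ
  refine ⟨δ', hδ', fun w hw h0 hS hP => ?_⟩
  have hw' : Monotone (fun i => w (-i)) ∨ Antitone (fun i => w (-i)) := by
    rcases hw with hw | hw
    · exact Or.inr fun a b hab => hw (neg_le_neg hab)
    · exact Or.inl fun a b hab => hw (neg_le_neg hab)
  have hP' : PO F δ (fun i => w (-i)) := by
    intro i
    have h1 := hP (-(i + 1))
    have h2 := H' _ _ h1
    rw [abs_sub_comm]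
    simpa using h2
  obtain ⟨y, hy⟩ := H (fun i => w (-i)) hw' (by simp [h0]) (fun i => hS _) hP'
  refine ⟨y, fun i => ?_⟩
  have := hy (-i)
  simpa using this

/-- crossing facts -/
lemma cross_up {F : Equiv.Perm ℝ} (h : StrictMono F) {δ : ℝ} {w : ℤ → ℝ} (hP : PO F δ w)
    {p : ℝ} {i j : ℤ} (hij : i < j) (hi : w i ≤ p) (hj : p ≤ w j) : p - δ ≤ F p := by
  revert hj
  induction j, hij using Int.leInduction with
  | base =>
    intro hj
    have h1 := abs_le.1 (hP i)
    have h2 := h.monotone hi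
    linarith
  | succ n hn ih =>
    intro hj
    by_cases hp : p ≤ w n
    · exact ih hp
    · have h1 := abs_le.1 (hP n)
      have h2 := h.monotone (not_le.1 hp).le
      linarith

lemma cross_down {F : Equiv.Perm ℝ} (h : StrictMono F) {δ : ℝ} {w : ℤ → ℝ} (hP : PO F δ w)
    {p : ℝ} {i j : ℤ} (hij : i < j) (hi : p ≤ w i) (hj : w j ≤ p) : F p ≤ p + δ := by
  revert hj
  induction j, hij using Int.leInduction with
  | base =>
    intro hj
    have h1 := abs_le.1 (hP i)
    have h2 := h.monotone hi
    linarith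
  | succ n hn ih =>
    intro hj
    by_cases hp : w n ≤ p
    · exact ih hp
    · have h1 := abs_le.1 (hP n)
      have h2 := h.monotone (not_le.1 hp).le
      linarith

/-- the sequence going up from `x` and stopping at `p`, and its tracing -/
lemma JL_trace {F : Equiv.Perm ℝ} {S : Set ℝ} {x : ℝ} (g : Good F S) {δ ε η : ℝ} (hδ : 0 < δ)
    (hη : 2 * δ ≤ η)
    (hx : x ∈ S)
    (H : ∀ w : ℤ → ℝ, (Monotone w ∨ Antitone w) → w 0 = x →
      (∀ i, w i ∈ S) → PO F η w → ∃ y, ∀ i, |(F ^ i) y - w i| ≤ ε)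
    {p : ℝ} (hp : p ∈ S) (hxp : x ≤ p) (hup : ∀ t, x ≤ t → t ≤ p → t - δ ≤ F t)
    (hpp : F p ≤ p + δ) :
    ∃ y, |y - x| ≤ ε ∧ ∃ K : ℕ, ∀ k : ℕ, K ≤ k → |(F ^ k) y - p| ≤ ε := by
  set G : Equiv.Perm ℝ := F.trans (Equiv.addRight (2 * δ)) with hG
  have hGa : ∀ t, G t = F t + 2 * δ := fun t => rfl
  have hGm : StrictMono G := fun a b hab => by
    rw [hGa, hGa]; linarith [g.mono hab]
  have hGx : x ≤ G x := by rw [hGa]; linarith [hup x le_rfl hxp]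
  have hGo := orbit_mono hGm hGx
  have hpS := hup p hxp le_rfl
  have hxS := hup x le_rfl hxp
  set w : ℤ → ℝ := fun k => if 0 ≤ k then min ((G ^ k) x) p else min ((F ^ k) x) x with hw
  have w1 : ∀ k, 0 ≤ k → w k = min ((G ^ k) x) p := fun k hk => by simp [hw, hk]
  have w0 : w 0 = x := by rw [w1 0 le_rfl]; simp [hxp]
  have w2 : ∀ k, k ≤ 0 → w k = min ((F ^ k) x) x := fun k hk => by
    rcases hk.lt_or_eq with hk | hk
    · simp [hw, not_le.2 hk]
    · subst hk; rw [w0]; simp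
  have hFneg : F x < x → ∀ k : ℤ, k ≤ 0 → x ≤ (F ^ k) x := fun h k hk => by
    simpa using orbit_anti g.mono h.le hk
  have hFpos : x ≤ F x → ∀ k : ℤ, k ≤ 0 → (F ^ k) x ≤ x := fun h k hk => by
    simpa using orbit_mono g.mono h hk
  have hFS : ∀ n : ℕ, (F ^ (-(n:ℤ))) x ∈ S := by
    intro n
    induction n with
    | zero => simpa using hx
    | succ n ih =>
      rw [← g.inv, ← zpow_succ_apply]
      convert ih using 3
      push_cast; ring
  have hmono : Monotone w := by
    apply monotone_int_of_le_succ
    intro k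
    by_cases hk : 0 ≤ k
    · rw [w1 k hk, w1 (k+1) (by omega)]
      exact min_le_min_right _ (hGo (by omega))
    · rw [w2 k (by omega), w2 (k+1) (by omega)]
      by_cases hc : F x < x
      · rw [min_eq_right (hFneg hc _ (by omega)), min_eq_right (hFneg hc _ (by omega))]
      · exact min_le_min_right _ (orbit_mono g.mono (not_lt.1 hc) (by omega))
  have hS : ∀ i, w i ∈ S := by
    intro k
    by_cases hk : 0 ≤ k
    · refine g.oc.out hx hp ⟨?_, ?_⟩
      · rw [← w0]; exact hmono hk
      · rw [w1 k hk]; exact min_le_right _ _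
    · rw [w2 k (by omega)]
      obtain ⟨n, hn⟩ := Int.eq_ofNat_of_zero_le (a := -k) (by omega)
      have := hFS n
      rw [← hn, neg_neg] at this
      rcases min_choice ((F ^ k) x) x with h | h <;> rw [h] <;> assumption
  have hPO : PO F η w := by
    intro k
    by_cases hk : 0 ≤ k
    · rw [w1 k hk, w1 (k+1) (by omega), g.mono.monotone.map_min, zpow_succ_apply, hGa]
      refine (abs_min_sub_min_le_max _ _ _ _).trans (max_le ?_ ?_)
      · rw [abs_le]; constructor <;> linarith
      · rw [abs_le]; constructor <;> linarith
    · rw [w2 k (by omega), w2 (k+1) (by omega), g.mono.monotone.map_min, ← zpow_succ_apply]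
      by_cases hc : F x < x
      · refine (abs_min_sub_min_le_max _ _ _ _).trans (max_le ?_ ?_)
        · simp; linarith
        · rw [abs_le]; constructor <;> linarith
      · have := hFpos (not_lt.1 hc) (k+1) (by omega)
        rw [min_eq_left this, min_eq_left (this.trans (not_lt.1 hc))]
        simp; linarith
  obtain ⟨y, hy⟩ := H w (Or.inl hmono) w0 hS hPO
  refine ⟨y, by simpa [w0] using hy 0, ?_⟩
  have hgrow : ∀ n : ℕ, min (x + n * δ) p ≤ (G ^ n) x := by
    intro n
    induction n with
    | zero => simp
    | succ n ih =>
      have e : (G ^ (n+1)) x = G ((G ^ n) x) := by rw [pow_succ']; rfl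
      rw [e]
      have hxn : x ≤ (G ^ n) x := by simpa using hGo (Int.natCast_nonneg n)
      by_cases hc : (G ^ n) x ≤ p
      · have := hup _ hxn hc
        rw [hGa]
        rcases min_choice (x + n * δ) p with h | h
        · rw [h] at ih
          refine (min_le_left _ _).trans ?_
          rw [Nat.cast_succ]; linarith
        · rw [h] at ih
          refine (min_le_right _ _).trans ?_
          linarith
      · refine (min_le_right _ _).trans ?_
        have := g.mono (not_le.1 hc)
        rw [hGa]; linarith
  obtain ⟨K, hK⟩ := exists_nat_gt ((p - x) / δ)
  rw [div_lt_iff₀ hδ] at hK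
  refine ⟨K, fun k hk => ?_⟩
  have h1 := hy k
  have h2 : w k = p := by
    rw [w1 _ (Int.natCast_nonneg k)]
    apply min_eq_right
    have h3 := hgrow K
    rw [min_eq_right (by linarith)] at h3
    have h4 : (G ^ (K:ℤ)) x ≤ (G ^ (k:ℤ)) x := hGo (by exact_mod_cast hk)
    simp only [zpow_natCast] at h4 ⊢
    linarith
  rw [h2] at h1
  simpa using h1

lemma JL {F : Equiv.Perm ℝ} {S : Set ℝ} {x : ℝ} (g : Good F S) (hM : Mon F S x) (hx : x ∈ S)
    {C : ℝ} (hC : 0 < C) : ∃ δ : ℝ, 0 < δ ∧ ∀ a b, x ≤ a → a + C ≤ b → b ∈ S →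
      (∀ p, x ≤ p → p ≤ b → p - δ ≤ F p) → (∀ p, a ≤ p → p ≤ b → F p ≤ p + δ) → False := by
  obtain ⟨η, hη, H⟩ := hM (C / 8) (by linarith)
  refine ⟨η / 2, by linarith, fun a b hxa hab hb h1 h2 => ?_⟩
  obtain ⟨y, hy, K, hK⟩ := JL_trace g (δ := η / 2) (by linarith) (by linarith) hx H hb (by linarith)
    h1 (h2 b (by linarith) le_rfl)
  obtain ⟨z, hz, L, hL⟩ := JL_trace g (δ := η / 2) (by linarith) (by linarith) hx H
    (p := (a + b) / 2) (g.oc.out hx hb ⟨by linarith, by linarith⟩) (by linarith)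
    (fun t ht ht' => h1 t ht (by linarith)) (h2 _ (by linarith) (by linarith))
  have e1 := abs_le.1 (hK K le_rfl)
  have e2 := abs_le.1 (hL L le_rfl)
  have e3 := abs_le.1 (hL (K + L) (by omega))
  have e4 := abs_le.1 hy
  have e5 : y ≤ (F ^ L) z := by linarith
  have e6 := (strictMono_pow g.mono K).monotone e5
  rw [← Equiv.Perm.mul_apply, ← pow_add] at e6
  linarith

lemma KR {F : Equiv.Perm ℝ} {S : Set ℝ} {x : ℝ} (g : Good F S) (hM : Mon F S x) (hx : x ∈ S)
    {C : ℝ} (hC : 0 < C) : ∃ δ : ℝ, 0 < δ ∧ ∀ w : ℤ → ℝ, w 0 = x → (∀ i, w i ∈ S) → PO F δ w →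
      ∀ a b, x ≤ a → a + C ≤ b → ∀ i j k l, i < j → w i ≤ a → b ≤ w j →
      k < l → b ≤ w k → w l ≤ a → False := by
  obtain ⟨δ1, hδ1, H1⟩ := JL g hM hx hC
  obtain ⟨δ2, hδ2, H2⟩ := JL g.inverse (hM.inverse g) hx hC
  obtain ⟨δ3, hδ3, H3⟩ := uc_le g.uc' hδ2
  refine ⟨min δ1 δ3, lt_min hδ1 hδ3, fun w w0 hS hP a b hxa hab i j k l hij hi hj hkl hk hl => ?_⟩
  have m1 := min_le_left δ1 δ3
  have m2 := min_le_right δ1 δ3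
  have up : ∀ p, a ≤ p → p ≤ b → p - min δ1 δ3 ≤ F p := fun p h1 h2 =>
    cross_up g.mono hP hij (by linarith) (by linarith)
  have dn : ∀ p, a ≤ p → p ≤ b → F p ≤ p + min δ1 δ3 := fun p h1 h2 =>
    cross_down g.mono hP hkl (by linarith) (by linarith)
  have hbS : b ∈ S := g.oc.out hx (hS j) ⟨by linarith, hj⟩
  rcases lt_trichotomy 0 j with h0 | h0 | h0
  · refine H1 a b hxa hab hbS (fun p h1 h2 => ?_) (fun p h1 h2 => ?_)
    · have := cross_up g.mono hP (p := p) h0 (by linarith) (by linarith)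
      linarith
    · have := dn p h1 h2
      linarith
  · subst h0; linarith
  · have gm := (strictMono_symm g.mono).monotone
    refine H2 a b hxa hab hbS (fun p h1 h2 => ?_) (fun p h1 h2 => ?_)
    · have h3 := cross_down g.mono hP (p := p) h0 (by linarith) (by linarith)
      have h4 : p ≤ F.symm (p + δ3) := by
        have := gm (h3.trans (by linarith : _ ≤ p + δ3)); simpa using this
      have h5 := abs_le.1 (H3 (p + δ3) p (by simp [abs_of_pos hδ3]))
      change _ ≤ F.symm p
      linarith
    · have h3 := up p h1 h2
      have h4 : F.symm (p - δ3) ≤ p := by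
        have := gm ((by linarith : p - δ3 ≤ _).trans h3); simpa using this
      have h5 := abs_le.1 (H3 (p - δ3) p (by simp [abs_of_pos hδ3]))
      change F.symm p ≤ _
      linarith

lemma PO.mono {F : Equiv.Perm ℝ} {δ δ' : ℝ} {w : ℤ → ℝ} (h : PO F δ w) (hd : δ ≤ δ') :
    PO F δ' w := fun i => (h i).trans hd

lemma PO.mirror {F : Equiv.Perm ℝ} {δ : ℝ} {w : ℤ → ℝ} (h : PO F δ w) :
    PO (mir F) δ (fun i => - w i) := by
  intro i
  have := h i
  rw [← abs_neg] at this
  rw [mir_apply, neg_neg]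
  convert this using 2
  ring

lemma KK {F : Equiv.Perm ℝ} {S : Set ℝ} {x : ℝ} (g : Good F S) (hM : Mon F S x) (hx : x ∈ S)
    {C : ℝ} (hC : 0 < C) : ∃ δ : ℝ, 0 < δ ∧ ∀ w : ℤ → ℝ, w 0 = x → (∀ i, w i ∈ S) → PO F δ w →
      ∀ a b, a + C ≤ b → ∀ i j k l, i < j → w i ≤ a → b ≤ w j →
      k < l → b ≤ w k → w l ≤ a → False := by
  obtain ⟨δ1, hδ1, H1⟩ := KR g hM hx (half_pos hC)
  obtain ⟨δ2, hδ2, H2⟩ := KR g.mirror hM.mirror (by simpa using hx) (half_pos hC)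
  refine ⟨min δ1 δ2, lt_min hδ1 hδ2, fun w w0 hS hP a b hab i j k l hij hi hj hkl hk hl => ?_⟩
  by_cases hc : x ≤ (a + b) / 2
  · exact H1 w w0 hS (hP.mono (min_le_left _ _)) ((a + b) / 2) b hc (by linarith) i j k l hij
      (by linarith) hj hkl hk (by linarith)
  · push Not at hc
    exact H2 (fun i => - w i) (by simp [w0]) (by simpa using hS)
      (hP.mono (min_le_right _ _)).mirror (-((a + b) / 2)) (-a)
      (by linarith) (by linarith) k l i j hkl (by linarith) (by linarith) hij
      (by linarith) (by linarith)

lemma UpC {F : Equiv.Perm ℝ} {S : Set ℝ} {x : ℝ} (g : Good F S) {δ ε C : ℝ}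
    (H : ∀ w : ℤ → ℝ, (Monotone w ∨ Antitone w) → w 0 = x →
      (∀ i, w i ∈ S) → PO F (2 * δ) w → ∃ y, ∀ i, |(F ^ i) y - w i| ≤ ε)
    (u : ℤ → ℝ) (u0 : u 0 = x) (hS : ∀ i, u i ∈ S) (hP : PO F δ u)
    (hC : 0 ≤ C) (hδ : 0 ≤ δ)
    (hup : ∀ i j, i < j → u i - C ≤ u j) (hF : x - 2 * δ ≤ F x) :
    ∃ y, ∀ i, |(F ^ i) y - u i| ≤ ε + C := by
  have ex : ∀ i : ℤ, ∃ v : ℝ,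
      (0 ≤ i → (∃ j, 0 ≤ j ∧ j ≤ i ∧ v = u j) ∧ ∀ j, 0 ≤ j → j ≤ i → u j ≤ v) ∧
      (i ≤ 0 → (∃ j, i ≤ j ∧ j ≤ 0 ∧ v = u j) ∧ ∀ j, i ≤ j → j ≤ 0 → v ≤ u j) := by
    intro i
    rcases lt_trichotomy 0 i with h | h | h
    · obtain ⟨j, hj, hm⟩ := (Finset.Icc 0 i).exists_max_image u ⟨0, by simp [h.le]⟩
      rw [Finset.mem_Icc] at hj
      exact ⟨u j, fun _ => ⟨⟨j, hj.1, hj.2, rfl⟩, fun k h1 h2 => hm k (by simp [h1, h2])⟩,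
        fun h' => by omega⟩
    · subst h
      refine ⟨u 0, fun _ => ⟨⟨0, le_rfl, le_rfl, rfl⟩, fun k h1 h2 => ?_⟩,
        fun _ => ⟨⟨0, le_rfl, le_rfl, rfl⟩, fun k h1 h2 => ?_⟩⟩
      · rw [le_antisymm h2 h1]
      · rw [le_antisymm h2 h1]
    · obtain ⟨j, hj, hm⟩ := (Finset.Icc i 0).exists_min_image u ⟨0, by simp [h.le]⟩
      rw [Finset.mem_Icc] at hj
      exact ⟨u j, fun h' => by omega,
        fun _ => ⟨⟨j, hj.1, hj.2, rfl⟩, fun k h1 h2 => hm k (by simp [h1, h2])⟩⟩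
  choose w wp wn using ex
  have w0 : w 0 = x := by
    obtain ⟨⟨j, h1, h2, h3⟩, -⟩ := wp 0 le_rfl
    rw [h3, le_antisymm h2 h1, u0]
  have hmono : Monotone w := by
    apply monotone_int_of_le_succ
    intro k
    by_cases hk : 0 ≤ k
    · obtain ⟨⟨j, h1, h2, h3⟩, -⟩ := wp k hk
      rw [h3]
      exact (wp (k+1) (by omega)).2 j h1 (by omega)
    · obtain ⟨⟨j, h1, h2, h3⟩, -⟩ := wn (k+1) (by omega)
      rw [h3]
      exact (wn k (by omega)).2 j (by omega) h2
  have hwS : ∀ i, w i ∈ S := by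
    intro i
    rcases le_total 0 i with h | h
    · obtain ⟨⟨j, h1, h2, h3⟩, -⟩ := wp i h
      rw [h3]; exact hS j
    · obtain ⟨⟨j, h1, h2, h3⟩, -⟩ := wn i h
      rw [h3]; exact hS j
  have hPw : PO F (2 * δ) w := by
    intro k
    rw [abs_le]
    by_cases hk : 0 ≤ k
    · obtain ⟨⟨j, h1, h2, h3⟩, h4⟩ := wp k hk
      obtain ⟨⟨j', h1', h2', h3'⟩, h4'⟩ := wp (k+1) (by omega)
      constructor
      · rw [h3']
        by_cases hj : j' = 0
        · subst hj
          have := g.mono.monotone (h4 0 le_rfl hk)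
          rw [u0] at this ⊢
          linarith
        · have e := abs_le.1 (hP (j' - 1))
          have := g.mono.monotone (h4 (j' - 1) (by omega) (by omega))
          rw [sub_add_cancel] at e
          linarith
      · rw [h3]
        have e := abs_le.1 (hP j)
        have := h4' (j + 1) (by omega) (by omega)
        linarith
    · obtain ⟨⟨j, h1, h2, h3⟩, h4⟩ := wn k (by omega)
      obtain ⟨⟨j', h1', h2', h3'⟩, h4'⟩ := wn (k+1) (by omega)
      constructor
      · rw [h3]
        by_cases hj : j = 0
        · subst hj
          have := h4' 0 (by omega) le_rfl
          rw [u0] at this ⊢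
          linarith
        · have e := abs_le.1 (hP j)
          have := h4' (j + 1) (by omega) (by omega)
          linarith
      · rw [h3']
        have e := abs_le.1 (hP (j' - 1))
        have := g.mono.monotone (h4 (j' - 1) (by omega) (by omega))
        rw [sub_add_cancel] at e
        linarith
  obtain ⟨y, hy⟩ := H w (Or.inl hmono) w0 hwS hPw
  refine ⟨y, fun i => ?_⟩
  have hd : |w i - u i| ≤ C := by
    rw [abs_le]
    rcases le_total 0 i with h | h
    · obtain ⟨⟨j, h1, h2, h3⟩, h4⟩ := wp i h
      have := h4 i h le_rfl
      refine ⟨by linarith, ?_⟩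
      rcases h2.lt_or_eq with h2 | h2
      · have := hup j i h2; linarith
      · subst h2; linarith
    · obtain ⟨⟨j, h1, h2, h3⟩, h4⟩ := wn i h
      have := h4 i le_rfl h
      refine ⟨?_, by linarith⟩
      rcases h1.lt_or_eq with h1 | h1
      · have := hup i j h1; linarith
      · subst h1; linarith
  calc |(F ^ i) y - u i| = |((F ^ i) y - w i) + (w i - u i)| := by ring_nf
    _ ≤ _ := (abs_add_le _ _).trans (add_le_add (hy i) hd)

lemma DownC {F : Equiv.Perm ℝ} {S : Set ℝ} {x : ℝ} (g : Good F S) {δ ε C : ℝ}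
    (H : ∀ w : ℤ → ℝ, (Monotone w ∨ Antitone w) → w 0 = x →
      (∀ i, w i ∈ S) → PO F (2 * δ) w → ∃ y, ∀ i, |(F ^ i) y - w i| ≤ ε)
    (u : ℤ → ℝ) (u0 : u 0 = x) (hS : ∀ i, u i ∈ S) (hP : PO F δ u)
    (hC : 0 ≤ C) (hδ : 0 ≤ δ)
    (hup : ∀ i j, i < j → u j ≤ u i + C) (hF : F x ≤ x + 2 * δ) :
    ∃ y, ∀ i, |(F ^ i) y - u i| ≤ ε + C := by
  have H' : ∀ w : ℤ → ℝ, (Monotone w ∨ Antitone w) → w 0 = -x →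
      (∀ i, w i ∈ {p | -p ∈ S}) → PO (mir F) (2 * δ) w →
      ∃ y, ∀ i, |((mir F) ^ i) y - w i| ≤ ε := by
    intro w hw h0 hS' hP'
    have e : mir (mir F) = F := by ext t; simp [mir_apply]
    have hw' : Monotone (fun i => - w i) ∨ Antitone (fun i => - w i) := by
      rcases hw with hw | hw
      · exact Or.inr hw.neg
      · exact Or.inl hw.neg
    obtain ⟨y, hy⟩ := H (fun i => - w i) hw' (by simp [h0]) hS' (e ▸ hP'.mirror)
    refine ⟨-y, fun i => ?_⟩
    have := hy i
    rw [mir_zpow, neg_neg, ← abs_neg]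
    convert this using 2
    ring
  obtain ⟨y, hy⟩ := UpC (x := -x) (δ := δ) (ε := ε) (C := C) g.mirror H' (fun i => - u i)
    (by simp [u0]) (by simpa using hS)
    hP.mirror hC hδ (fun i j hij => by linarith [hup i j hij]) (by rw [mir_apply, neg_neg]; linarith)
  refine ⟨-y, fun i => ?_⟩
  have := hy i
  rw [mir_zpow, ← abs_neg] at this
  convert this using 2
  ring

lemma up_or_down {w : ℤ → ℝ} {C : ℝ}
    (H : ∀ a b, a + C / 2 ≤ b → ∀ i j k l, i < j → w i ≤ a → b ≤ w j →
      k < l → b ≤ w k → w l ≤ a → False) (hC : 0 < C) :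
    (∀ i j, i < j → w i - C ≤ w j) ∨ (∀ i j, i < j → w j ≤ w i + C) := by
  by_contra hc
  push Not at hc
  obtain ⟨⟨i, j, hij, h1⟩, ⟨k, l, hkl, h2⟩⟩ := hc
  by_cases hm : (w i + w j) / 2 ≤ (w k + w l) / 2
  · rcases lt_trichotomy j l with h | h | h
    · exact H (w j) ((w i + w j) / 2) (by linarith) j l i j h le_rfl (by linarith) hij
        (by linarith) le_rfl
    · subst h; linarith
    · exact H ((w k + w l) / 2) (w l) (by linarith) k l l j hkl (by linarith) le_rfl h le_rfl
        (by linarith)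
  · push Not at hm
    rcases lt_trichotomy k i with h | h | h
    · exact H ((w i + w j) / 2) (w i) (by linarith) k i i j h (by linarith) le_rfl hij le_rfl
        (by linarith)
    · subst h; linarith
    · exact H (w k) ((w k + w l) / 2) (by linarith) k l i k hkl le_rfl (by linarith) h
        (by linarith) le_rfl

/-- shadowing of all `S`-valued pseudo orbits -/
lemma Inc {F : Equiv.Perm ℝ} {S : Set ℝ} {x : ℝ} (g : Good F S) (hM : Mon F S x) (hx : x ∈ S)
    {ε : ℝ} (hε : 0 < ε) : ∃ δ : ℝ, 0 < δ ∧ ∀ w : ℤ → ℝ, w 0 = x → (∀ i, w i ∈ S) → PO F δ w →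
      ∃ y, ∀ i, |(F ^ i) y - w i| ≤ ε := by
  obtain ⟨δ1, hδ1, H1⟩ := KK g hM hx (C := ε / 8) (by linarith)
  obtain ⟨δ2, hδ2, H2⟩ := hM (ε / 2) (by linarith)
  set δ := min δ1 (δ2 / 2) with hδd
  have hδ : 0 < δ := lt_min hδ1 (by linarith)
  have m1 : δ ≤ δ1 := min_le_left _ _
  have m2 : δ ≤ δ2 / 2 := min_le_right _ _
  refine ⟨δ, hδ, fun w w0 hS hP => ?_⟩
  have hud := up_or_down (w := w) (C := ε / 4) (fun a b hab => H1 w w0 hS (hP.mono m1) a b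
    (by linarith)) (by linarith)
  have H : ∀ w : ℤ → ℝ, (Monotone w ∨ Antitone w) → w 0 = x →
      (∀ i, w i ∈ S) → PO F (2 * δ) w → ∃ y, ∀ i, |(F ^ i) y - w i| ≤ ε / 2 :=
    fun w h1 h2 h3 h4 => H2 w h1 h2 h3 (h4.mono (by linarith))
  have fin : (∃ y, ∀ i, |(F ^ i) y - w i| ≤ ε / 2 + ε / 2) → ∃ y, ∀ i, |(F ^ i) y - w i| ≤ ε := by
    rw [add_halves]; exact id
  apply fin
  rcases hud with hu | hd
  · by_cases hF : x - 2 * δ ≤ F x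
    · exact UpC g H w w0 hS hP (by linarith) hδ.le
        (fun i j hij => by linarith [hu i j hij]) hF
    · have hpos : ∀ i, 0 < i → w i ≤ x := fun i hi => by
        by_contra hc
        have := cross_up g.mono hP (p := x) hi w0.le (not_le.1 hc).le
        linarith
      have hneg : ∀ i, i < 0 → x ≤ w i := fun i hi => by
        by_contra hc
        have := cross_up g.mono hP (p := x) hi (not_le.1 hc).le w0.ge
        linarith
      have hp' : ∀ j, w j ≤ x + ε / 4 := fun j => by
        rcases lt_trichotomy 0 j with h | h | h
        · linarith [hpos j h]
        · subst h; linarith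
        · linarith [hu j 0 h]
      have hn' : ∀ j, x - ε / 4 ≤ w j := fun j => by
        rcases lt_trichotomy 0 j with h | h | h
        · linarith [hu 0 j h]
        · subst h; linarith
        · linarith [hneg j h]
      exact DownC g H w w0 hS hP (by linarith) hδ.le
        (fun i j hij => by linarith [hp' j, hn' i]) (by linarith)
  · by_cases hF : F x ≤ x + 2 * δ
    · exact DownC g H w w0 hS hP (by linarith) hδ.le
        (fun i j hij => by linarith [hd i j hij]) hF
    · have hpos : ∀ i, 0 < i → x ≤ w i := fun i hi => by
        by_contra hc
        have := cross_down g.mono hP (p := x) hi w0.ge (not_le.1 hc).le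
        linarith
      have hneg : ∀ i, i < 0 → w i ≤ x := fun i hi => by
        by_contra hc
        have := cross_down g.mono hP (p := x) hi (not_le.1 hc).le w0.le
        linarith
      have hn' : ∀ j, x - ε / 4 ≤ w j := fun j => by
        rcases lt_trichotomy 0 j with h | h | h
        · linarith [hpos j h]
        · subst h; linarith
        · linarith [hd j 0 h]
      have hp' : ∀ j, w j ≤ x + ε / 4 := fun j => by
        rcases lt_trichotomy 0 j with h | h | h
        · linarith [hd 0 j h]
        · subst h; linarith
        · linarith [hneg j h]
      exact UpC g H w w0 hS hP (by linarith) hδ.le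
        (fun i j hij => by linarith [hp' i, hn' j]) (by linarith)

end WtsAux
namespace WtsAux

def Bl (lam Lam : ℝ) (φ : ℝ → ℝ) : Prop :=
  ∀ s t, s ≤ t → lam * (t - s) ≤ φ t - φ s ∧ φ t - φ s ≤ Lam * (t - s)

lemma Bl.max' {l L : ℝ} {φ ψ : ℝ → ℝ} (h : Bl l L φ) (h' : Bl l L ψ) :
    Bl l L fun t => max (φ t) (ψ t) := by
  intro s t hst
  obtain ⟨a, b⟩ := h s t hst
  obtain ⟨c, d⟩ := h' s t hst
  beta_reduce
  constructor
  · rcases max_choice (φ s) (ψ s) with e | e <;> rw [e]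
    · linarith [le_max_left (φ t) (ψ t)]
    · linarith [le_max_right (φ t) (ψ t)]
  · rcases max_choice (φ t) (ψ t) with e | e <;> rw [e]
    · linarith [le_max_left (φ s) (ψ s)]
    · linarith [le_max_right (φ s) (ψ s)]

lemma Bl.min' {l L : ℝ} {φ ψ : ℝ → ℝ} (h : Bl l L φ) (h' : Bl l L ψ) :
    Bl l L fun t => min (φ t) (ψ t) := by
  intro s t hst
  obtain ⟨a, b⟩ := h s t hst
  obtain ⟨c, d⟩ := h' s t hst
  beta_reduce
  constructor
  · rcases min_choice (φ t) (ψ t) with e | e <;> rw [e]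
    · linarith [min_le_left (φ s) (ψ s)]
    · linarith [min_le_right (φ s) (ψ s)]
  · rcases min_choice (φ s) (ψ s) with e | e <;> rw [e]
    · linarith [min_le_left (φ t) (ψ t)]
    · linarith [min_le_right (φ t) (ψ t)]

lemma Bl.sup' {l L : ℝ} {T : Finset ℤ} (hT : T.Nonempty) {φ : ℤ → ℝ → ℝ}
    (h : ∀ i, Bl l L (φ i)) : Bl l L fun t => T.sup' hT fun i => φ i t := by
  intro s t hst
  obtain ⟨i, hi, ei⟩ := T.exists_mem_eq_sup' hT fun i => φ i s
  obtain ⟨j, hj, ej⟩ := T.exists_mem_eq_sup' hT fun i => φ i t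
  have h1 := Finset.le_sup' (fun i => φ i t) hi
  have h2 := Finset.le_sup' (fun i => φ i s) hj
  have h3 := h i s t hst
  have h4 := h j s t hst
  simp only at *
  constructor
  · rw [ei]; linarith
  · rw [ej]; linarith

lemma Bl.lin {l L c : ℝ} (h1 : l ≤ c) (h2 : c ≤ L) (a b : ℝ) : Bl l L fun t => b + c * (t - a) := by
  intro s t hst
  constructor <;> nlinarith

lemma exists_lam (T : Finset (ℤ × ℤ)) (P Q : ℤ × ℤ → ℝ) :
    ∃ lam : ℝ, 0 < lam ∧ lam ≤ 1 ∧ ∀ p ∈ T, 0 < Q p → lam * P p ≤ Q p := by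
  induction T using Finset.induction_on with
  | empty => exact ⟨1, one_pos, le_rfl, by simp⟩
  | insert p T hp ih =>
    obtain ⟨l, h0, h1, h2⟩ := ih
    by_cases hQ : 0 < Q p
    · refine ⟨min l (Q p / (|P p| + 1)), lt_min h0 (by positivity),
        (min_le_left _ _).trans h1, fun q hq hq0 => ?_⟩
      have hpos : 0 < min l (Q p / (|P p| + 1)) := lt_min h0 (by positivity)
      rcases Finset.mem_insert.1 hq with rfl | hq
      · calc min l (Q q / (|P q| + 1)) * P q ≤ min l (Q q / (|P q| + 1)) * (|P q| + 1) := by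
              apply mul_le_mul_of_nonneg_left _ hpos.le
              linarith [le_abs_self (P q)]
          _ ≤ Q q / (|P q| + 1) * (|P q| + 1) := by
              apply mul_le_mul_of_nonneg_right (min_le_right _ _); positivity
          _ = Q q := by field_simp
      · have := h2 q hq hq0
        by_cases hs : 0 ≤ P q
        · exact (mul_le_mul_of_nonneg_right (min_le_left _ _) hs).trans this
        · push Not at hs
          nlinarith
    · refine ⟨l, h0, h1, fun q hq hq0 => ?_⟩
      rcases Finset.mem_insert.1 hq with rfl | hq
      · exact absurd hq0 hQ
      · exact h2 q hq hq0

lemma interp (T : Finset ℤ) (a b : ℤ → ℝ) {δ : ℝ} (hδ : 0 ≤ δ)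
    (h1 : ∀ i ∈ T, ∀ j ∈ T, a i < a j → b i < b j)
    (h2 : ∀ i ∈ T, ∀ j ∈ T, a i = a j → b i = b j)
    (h3 : ∀ i ∈ T, |a i - b i| ≤ δ) :
    ∃ φ : Equiv.Perm ℝ, IsUniformEquiv φ ∧ (∀ t, |φ t - t| ≤ δ) ∧ ∀ i ∈ T, φ (a i) = b i := by
  rcases T.eq_empty_or_nonempty with rfl | hT
  · refine ⟨1, ⟨uniformContinuous_id, uniformContinuous_id⟩, by simp [hδ], by simp⟩
  obtain ⟨l, l0, l1, hl⟩ := exists_lam (T ×ˢ T) (fun p => a p.2 - a p.1) (fun p => b p.2 - b p.1)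
  obtain ⟨m, m0, m1, hm⟩ := exists_lam (T ×ˢ T) (fun p => b p.2 - b p.1) (fun p => a p.2 - a p.1)
  have hL1 : 1 ≤ m⁻¹ := (one_le_inv₀ m0).2 m1
  set L := m⁻¹ with hLdef
  have hl' : ∀ i ∈ T, ∀ j ∈ T, a i < a j → l * (a j - a i) ≤ b j - b i := fun i hi j hj hij =>
    hl (i, j) (by simp [hi, hj]) (by simpa using h1 i hi j hj hij)
  have hm' : ∀ i ∈ T, ∀ j ∈ T, a i < a j → b j - b i ≤ L * (a j - a i) := fun i hi j hj hij => by
    have := hm (i, j) (by simp [hi, hj]) (by simpa using hij)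
    simp only at this
    rw [hLdef, inv_mul_eq_div, le_div_iff₀ m0, mul_comm]
    exact this
  set ψ : ℝ → ℝ := fun t => T.sup' hT fun i =>
    min (b i + l * (t - a i)) (b i + L * (t - a i)) with hψ
  have hψB : Bl l L ψ := Bl.sup' hT fun i =>
    (Bl.lin le_rfl (by linarith) _ _).min' (Bl.lin (by linarith) le_rfl _ _)
  have hψa : ∀ i ∈ T, ψ (a i) = b i := by
    intro i hi
    apply le_antisymm
    · apply Finset.sup'_le
      intro j hj
      rcases lt_trichotomy (a i) (a j) with h | h | h
      · refine (min_le_right _ _).trans ?_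
        have := hm' i hi j hj h
        linarith
      · rw [h2 i hi j hj h, h]; simp
      · refine (min_le_left _ _).trans ?_
        have := hl' j hj i hi h
        linarith
    · have := Finset.le_sup' (fun j => min (b j + l * (a i - a j)) (b j + L * (a i - a j))) hi
      simpa using this
  set χ : ℝ → ℝ := fun t => min (max (ψ t) (-δ + 1 * (t - 0))) (δ + 1 * (t - 0)) with hχ
  have hχB : Bl l L χ := (hψB.max' (Bl.lin l1 hL1 _ _)).min' (Bl.lin l1 hL1 _ _)
  have hχa : ∀ i ∈ T, χ (a i) = b i := by
    intro i hi
    have := abs_le.1 (h3 i hi)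
    simp only [hχ]
    rw [hψa i hi, max_eq_left (by linarith), min_eq_left (by linarith)]
  have hχd : ∀ t, |χ t - t| ≤ δ := by
    intro t
    rw [abs_le]
    constructor
    · have : t - δ ≤ χ t := le_min (le_trans (by linarith) (le_max_right _ _)) (by linarith)
      linarith
    · have : χ t ≤ δ + 1 * (t - 0) := min_le_right _ _
      linarith
  have hle : ∀ s t, |χ s - χ t| ≤ L * |s - t| := by
    intro s t
    rcases le_total s t with h | h
    · have := hχB s t h
      rw [abs_sub_comm, abs_sub_comm s, abs_of_nonneg (sub_nonneg.2 h), abs_of_nonneg]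
      · exact this.2
      · nlinarith
    · have := hχB t s h
      rw [abs_of_nonneg (sub_nonneg.2 h), abs_of_nonneg]
      · exact this.2
      · nlinarith
  have hge : ∀ s t, l * |s - t| ≤ |χ s - χ t| := by
    intro s t
    rcases le_total s t with h | h
    · have := hχB s t h
      rw [abs_sub_comm s t, abs_of_nonneg (sub_nonneg.2 h), abs_sub_comm]
      exact this.1.trans (le_abs_self _)
    · have := hχB t s h
      rw [abs_of_nonneg (sub_nonneg.2 h)]
      exact this.1.trans (le_abs_self _)
  have hcont : UniformContinuous χ := by
    rw [Metric.uniformContinuous_iff]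
    intro ε hε
    refine ⟨ε / L, by positivity, fun s t hst => ?_⟩
    rw [Real.dist_eq] at *
    rw [lt_div_iff₀ (by linarith)] at hst
    linarith [hle s t]
  have hinj : Function.Injective χ := by
    intro s t hst
    have := hge s t
    rw [hst, sub_self, abs_zero] at this
    have h0 : |s - t| ≤ 0 := by
      by_contra hc; push Not at hc; nlinarith
    have := abs_eq_zero.1 (le_antisymm h0 (abs_nonneg _))
    linarith
  have hsurj : Function.Surjective χ := by
    apply hcont.continuous.surjective
    · apply Filter.tendsto_atTop_mono (f := fun t => t - δ)
      · intro t; linarith [(abs_le.1 (hχd t)).1]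
      · exact Filter.tendsto_atTop_add_const_right _ _ Filter.tendsto_id
    · refine Filter.tendsto_atBot_mono (fun t => (?_ : χ t ≤ t + δ)) ?_
      · linarith [(abs_le.1 (hχd t)).2]
      · exact Filter.tendsto_atBot_add_const_right _ _ Filter.tendsto_id
  refine ⟨Equiv.ofBijective χ ⟨hinj, hsurj⟩, ⟨hcont, ?_⟩, hχd, hχa⟩
  rw [Metric.uniformContinuous_iff]
  intro ε hε
  refine ⟨ε * l, by positivity, fun s t hst => ?_⟩
  rw [Real.dist_eq] at *
  have := hge ((Equiv.ofBijective χ ⟨hinj, hsurj⟩).symm s)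
    ((Equiv.ofBijective χ ⟨hinj, hsurj⟩).symm t)
  have e : ∀ s, χ ((Equiv.ofBijective χ ⟨hinj, hsurj⟩).symm s) = s :=
    fun s => (Equiv.ofBijective χ ⟨hinj, hsurj⟩).apply_symm_apply s
  rw [e, e] at this
  by_contra hc
  push Not at hc
  nlinarith

lemma FC {f : Equiv.Perm ℝ} {x : ℝ} (hf : IsUniformEquiv f) (hP : IsAlphaPersistentPt f x)
    {ε : ℝ} (hε : 0 < ε) : ∃ δ : ℝ, 0 < δ ∧ ∀ (N : ℕ) (ρ : ℤ → ℝ), ρ 0 = x →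
      (∀ i, -(N:ℤ) ≤ i → i < N → |f (ρ i) - ρ (i + 1)| ≤ δ) →
      (∀ i j, -(N:ℤ) ≤ i → i < N → -(N:ℤ) ≤ j → j < N → f (ρ i) < f (ρ j) →
        ρ (i + 1) < ρ (j + 1)) →
      (∀ i j, -(N:ℤ) ≤ i → i < N → -(N:ℤ) ≤ j → j < N → f (ρ i) = f (ρ j) →
        ρ (i + 1) = ρ (j + 1)) →
      ∃ y, ∀ i, -(N:ℤ) ≤ i → i ≤ N → |(f ^ i) y - ρ i| ≤ ε := by
  obtain ⟨δ, hδ, H⟩ := hP ε hε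
  refine ⟨δ / 2, by linarith, fun N ρ ρ0 h1 h2 h3 => ?_⟩
  obtain ⟨φ, hφ, hd, hφa⟩ := interp (Finset.Ico (-(N:ℤ)) N) (fun i => f (ρ i))
    (fun i => ρ (i + 1)) (δ := δ / 2) (by linarith)
    (fun i hi j hj => by
      rw [Finset.mem_Ico] at hi hj; exact h2 i j hi.1 hi.2 hj.1 hj.2)
    (fun i hi j hj => by
      rw [Finset.mem_Ico] at hi hj; exact h3 i j hi.1 hi.2 hj.1 hj.2)
    (fun i hi => by rw [Finset.mem_Ico] at hi; exact h1 i hi.1 hi.2)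
  set g : Equiv.Perm ℝ := φ * f with hg
  have hga : ∀ t, g t = φ (f t) := fun t => rfl
  have hgρ : ∀ i, -(N:ℤ) ≤ i → i < N → g (ρ i) = ρ (i + 1) := fun i hi hi' =>
    hφa i (by simp [hi, hi'])
  have hgu : IsUniformEquiv g := ⟨hφ.1.comp hf.1, hf.2.comp hφ.2⟩
  have hgd : C0Dist f g < δ := by
    have : C0Dist f g ≤ δ / 2 := by
      apply ciSup_le
      intro t
      refine (min_le_left _ _).trans ?_
      rw [Real.dist_eq, abs_sub_comm]
      exact hd _
    linarith
  obtain ⟨y, hy⟩ := H g hgu hgd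
  have hpos : ∀ n : ℕ, n ≤ N → (g ^ (n : ℤ)) x = ρ n := by
    intro n
    induction n with
    | zero => intro _; simp [ρ0]
    | succ n ih =>
      intro hn
      rw [Nat.cast_succ, zpow_succ_apply, ih (by omega), hgρ _ (by omega) (by omega)]
  have hneg : ∀ n : ℕ, n ≤ N → (g ^ (-(n : ℤ))) x = ρ (-n) := by
    intro n
    induction n with
    | zero => intro _; simp [ρ0]
    | succ n ih =>
      intro hn
      apply g.injective
      rw [← zpow_succ_apply, hgρ _ (by omega) (by omega)]
      have e : -((n + 1 : ℕ) : ℤ) + 1 = -n := by push_cast; ring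
      rw [e, ih (by omega)]
  refine ⟨y, fun i hi hi' => ?_⟩
  have hgi : (g ^ i) x = ρ i := by
    rcases le_total 0 i with h | h
    · obtain ⟨n, rfl⟩ := Int.eq_ofNat_of_zero_le h
      exact hpos n (by omega)
    · obtain ⟨n, hn⟩ := Int.eq_ofNat_of_zero_le (a := -i) (by omega)
      have := hneg n (by omega)
      rwa [← hn, neg_neg] at this
  have := hy i
  rw [hgi, Real.dist_eq] at this
  exact this.le

lemma cpt {F : Equiv.Perm ℝ} (h : Continuous F) (h' : Continuous F.symm) {w : ℤ → ℝ} {ε : ℝ}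
    (H : ∀ N : ℕ, ∃ y, ∀ i, -(N:ℤ) ≤ i → i ≤ N → |(F ^ i) y - w i| ≤ ε) :
    ∃ y, ∀ i, |(F ^ i) y - w i| ≤ ε := by
  have hcl : ∀ N : ℕ, IsClosed {y | ∀ i : ℤ, -(N:ℤ) ≤ i → i ≤ N → |(F ^ i) y - w i| ≤ ε} := by
    intro N
    simp only [Set.ofPred_forall]
    refine isClosed_iInter fun i => isClosed_iInter fun _ => isClosed_iInter fun _ => ?_
    exact isClosed_le ((continuous_zpow' h h' i).sub continuous_const).abs continuous_const
  have key := IsCompact.nonempty_iInter_of_sequence_nonempty_isCompact_isClosed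
    (fun N : ℕ => {y | ∀ i : ℤ, -(N:ℤ) ≤ i → i ≤ N → |(F ^ i) y - w i| ≤ ε}) ?_ H ?_ hcl
  · obtain ⟨y, hy⟩ := key
    rw [Set.mem_iInter] at hy
    refine ⟨y, fun i => hy i.natAbs i (by omega) (by omega)⟩
  · intro N y hy i hi hi'
    exact hy i (by push_cast; omega) (by push_cast; omega)
  · apply (isCompact_Icc (a := w 0 - ε) (b := w 0 + ε)).of_isClosed_subset (hcl 0)
    intro y hy
    have := abs_le.1 (hy 0 (by simp) (by simp))
    simp only [zpow_zero, Equiv.Perm.coe_one, id_eq] at this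
    exact ⟨by linarith, by linarith⟩

lemma perturb {w : ℤ → ℝ} (hw : Monotone w ∨ Antitone w) (N : ℕ) {θ : ℝ} (hθ : 0 < θ) :
    ∃ w' : ℤ → ℝ, w' 0 = w 0 ∧ (StrictMono w' ∨ StrictAnti w') ∧
      ∀ i, -(N:ℤ) ≤ i → i ≤ N → |w' i - w i| ≤ θ := by
  set η := θ / (N + 1) with hη
  have hη0 : 0 < η := by positivity
  have hb : ∀ i : ℤ, -(N:ℤ) ≤ i → i ≤ N → |η * i| ≤ θ := by
    intro i h1 h2
    have h1' : -(N:ℝ) ≤ i := by exact_mod_cast h1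
    have h2' : (i:ℝ) ≤ N := by exact_mod_cast h2
    have e : η * (N + 1) = θ := by rw [hη]; field_simp
    rw [abs_le]
    constructor <;> nlinarith
  rcases hw with hw | hw
  · refine ⟨fun i => w i + η * i, by simp, Or.inl fun i j hij => ?_, fun i h1 h2 => ?_⟩
    · have := hw hij.le
      have h3 : (i:ℝ) < j := by exact_mod_cast hij
      have := mul_lt_mul_of_pos_left h3 hη0
      simp only; linarith
    · simpa using hb i h1 h2
  · refine ⟨fun i => w i - η * i, by simp, Or.inr fun i j hij => ?_, fun i h1 h2 => ?_⟩
    · have := hw hij.le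
      have h3 : (i:ℝ) < j := by exact_mod_cast hij
      have := mul_lt_mul_of_pos_left h3 hη0
      simp only; linarith
    · have := hb i h1 h2
      rw [← abs_neg] at this
      convert this using 2
      ring

lemma shift_lt {w : ℤ → ℝ} (h : StrictMono w ∨ StrictAnti w) {i j : ℤ} (hij : w i < w j) :
    w (i + 1) < w (j + 1) := by
  rcases h with h | h
  · exact h (by have := h.lt_iff_lt.1 hij; omega)
  · exact h (by have := h.lt_iff_gt.1 hij; omega)

lemma shift_eq {w : ℤ → ℝ} (h : StrictMono w ∨ StrictAnti w) {i j : ℤ} (hij : w i = w j) :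
    w (i + 1) = w (j + 1) := by
  have : i = j := by
    rcases h with h | h
    · exact h.injective hij
    · exact h.injective hij
  rw [this]

lemma mon_inc {f : Equiv.Perm ℝ} {x : ℝ} (hf : IsUniformEquiv f) (hm : StrictMono f)
    (hP : IsAlphaPersistentPt f x) : Mon f Set.univ x := by
  intro ε hε
  obtain ⟨δ, hδ, H⟩ := FC hf hP (half_pos hε)
  refine ⟨δ / 2, by linarith, fun w hw w0 _ hPO => ?_⟩
  apply cpt hf.1.continuous hf.2.continuous
  intro N
  obtain ⟨θ, hθ, Hθ⟩ := uc_le hf.1 (ε := δ / 4) (by linarith)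
  obtain ⟨w', w0', hs, hc⟩ := perturb hw N (θ := min θ (min (ε / 2) (δ / 4)))
    (lt_min hθ (lt_min (by linarith) (by linarith)))
  have m1 := min_le_left θ (min (ε / 2) (δ / 4))
  have m2 := (min_le_right θ (min (ε / 2) (δ / 4))).trans (min_le_left _ _)
  have m3 := (min_le_right θ (min (ε / 2) (δ / 4))).trans (min_le_right _ _)
  have key : ∃ y, ∀ i, -(N:ℤ) ≤ i → i ≤ N → |(f ^ i) y - w' i| ≤ ε / 2 := by
    apply H N w' (by rw [w0', w0])
    · intro i h1 h2
      have e1 := abs_le.1 (Hθ _ _ ((hc i h1 h2.le).trans m1))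
      have e2 := abs_le.1 (hc (i + 1) (by omega) (by omega))
      have e3 := abs_le.1 (hPO i)
      rw [abs_le]; constructor <;> linarith
    · intro i j _ _ _ _ h
      exact shift_lt hs (hm.lt_iff_lt.1 h)
    · intro i j _ _ _ _ h
      exact shift_eq hs (f.injective h)
  obtain ⟨y, hy⟩ := key
  refine ⟨y, fun i h1 h2 => ?_⟩
  have e1 := abs_le.1 (hy i h1 h2)
  have e2 := abs_le.1 (hc i h1 h2)
  rw [abs_le]; constructor <;> linarith

lemma sq_zpow (f : Equiv.Perm ℝ) (i : ℤ) : (f * f) ^ i = f ^ (2 * i) := by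
  rw [zpow_mul, zpow_ofNat, pow_two]

lemma mon_dec {f : Equiv.Perm ℝ} {x c : ℝ} (hf : IsUniformEquiv f) (hm : StrictAnti f)
    (hc : f c = c) (hP : IsAlphaPersistentPt f x) : Mon (f * f) (Set.Ici c) x := by
  intro ε hε
  obtain ⟨δ, hδ, H⟩ := FC hf hP (half_pos hε)
  refine ⟨δ / 4, by linarith, fun w hw w0 hS hPO => ?_⟩
  apply cpt (F := f * f) (hf.1.comp hf.1).continuous (hf.2.comp hf.2).continuous
  intro N
  obtain ⟨r, hr, Hr⟩ := uc_le hf.1 (ε := δ / 8) (by linarith)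
  obtain ⟨d, hd, hd1, hd2⟩ : ∃ d : ℝ, 0 < d ∧ 3 * d ≤ r ∧ 12 * d ≤ δ :=
    ⟨min (r / 3) (δ / 12), lt_min (by linarith) (by linarith),
      by linarith [min_le_left (r / 3) (δ / 12)], by linarith [min_le_right (r / 3) (δ / 12)]⟩
  obtain ⟨θ', hθ', Hθ'⟩ := uc_le hf.1 hd
  obtain ⟨θ, hθ, hθ1, hθ2, hθ3⟩ : ∃ θ : ℝ, 0 < θ ∧ θ ≤ θ' ∧ θ ≤ d ∧ θ ≤ ε / 2 :=
    ⟨min θ' (min d (ε / 2)), lt_min hθ' (lt_min hd (by linarith)), min_le_left _ _,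
      (min_le_right _ _).trans (min_le_left _ _), (min_le_right _ _).trans (min_le_right _ _)⟩
  obtain ⟨w', w0', hs, hcl⟩ := perturb hw N hθ
  have hE : ∀ k, -(N:ℤ) ≤ k → k ≤ N → c - θ ≤ w' k := fun k h1 h2 => by
    have e1 := abs_le.1 (hcl k h1 h2)
    have e2 : c ≤ w k := hS k
    linarith
  have hO : ∀ k, -(N:ℤ) ≤ k → k ≤ N → f (w' k) - 3 * d < c - θ := fun k h1 h2 => by
    have e1 := hm.antitone (hE k h1 h2)
    have e2 := abs_le.1 (Hθ' (c - θ) c (by simpa [abs_of_pos hθ] using hθ1))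
    rw [hc] at e2
    linarith
  set ρ : ℤ → ℝ := fun i => if Even i then w' (i / 2) else f (w' (i / 2)) - 3 * d with hρ
  have re : ∀ k, ρ (2 * k) = w' k := fun k => by simp [hρ]
  have ro : ∀ k, ρ (2 * k + 1) = f (w' k) - 3 * d := fun k => by
    have h1 : ¬ Even (2 * k + 1) := by simp
    have h2 : (2 * k + 1) / 2 = k := by omega
    simp only [hρ, if_neg h1, h2]
  have ro' : ∀ k, ρ (2 * k + 1 + 1) = w' (k + 1) := fun k => by
    rw [← re]; congr 1; ring
  have key : ∃ y, ∀ i, -((2 * N : ℕ):ℤ) ≤ i → i ≤ (2 * N : ℕ) → |(f ^ i) y - ρ i| ≤ ε / 2 := by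
    apply H (2 * N) ρ
    · have := re 0
      rw [mul_zero] at this
      rw [this, w0', w0]
    · intro i h1 h2
      push_cast at h1 h2
      obtain ⟨k, rfl | rfl⟩ := Int.even_or_odd' i
      · rw [re, ro, sub_sub_cancel, abs_of_pos (by linarith)]; linarith
      · rw [ro', ro]
        have e1 := abs_le.1 (Hr (f (w' k) - 3 * d) (f (w' k)) (by
          rw [sub_sub_cancel_left, abs_neg, abs_of_pos (by linarith)]; exact hd1))
        have e2 := abs_le.1 (Hr (f (w' k)) (f (w k)) ((Hθ' _ _
          ((hcl k (by omega) (by omega)).trans hθ1)).trans (by linarith)))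
        have e3 := abs_le.1 (hPO k)
        have e4 := abs_le.1 (hcl (k + 1) (by omega) (by omega))
        rw [Equiv.Perm.mul_apply] at e3
        rw [abs_le]; constructor <;> linarith
    · intro i j hi hi' hj hj' hij
      push_cast at hi hi' hj hj'
      have hij := hm.lt_iff_gt.1 hij
      obtain ⟨k, rfl | rfl⟩ := Int.even_or_odd' i <;> obtain ⟨l, rfl | rfl⟩ := Int.even_or_odd' j
      · rw [re, re] at hij
        rw [ro, ro]
        linarith [hm hij]
      · rw [ro, ro']
        linarith [hO k (by omega) (by omega), hE (l + 1) (by omega) (by omega)]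
      · rw [re, ro] at hij
        linarith [hO k (by omega) (by omega), hE l (by omega) (by omega)]
      · rw [ro, ro] at hij
        rw [ro', ro']
        exact shift_lt hs (hm.lt_iff_gt.1 (by linarith : f (w' l) < f (w' k)))
    · intro i j hi hi' hj hj' hij
      push_cast at hi hi' hj hj'
      have hij := f.injective hij
      obtain ⟨k, rfl | rfl⟩ := Int.even_or_odd' i <;> obtain ⟨l, rfl | rfl⟩ := Int.even_or_odd' j
      · rw [re, re] at hij
        rw [ro, ro, hij]
      · rw [re, ro] at hij
        linarith [hO l (by omega) (by omega), hE k (by omega) (by omega)]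
      · rw [re, ro] at hij
        linarith [hO k (by omega) (by omega), hE l (by omega) (by omega)]
      · rw [ro, ro] at hij
        rw [ro', ro']
        exact shift_eq hs (f.injective (by linarith))
  obtain ⟨y, hy⟩ := key
  refine ⟨y, fun i h1 h2 => ?_⟩
  have e1 := abs_le.1 (hy (2 * i) (by push_cast; omega) (by push_cast; omega))
  have e2 := abs_le.1 (hcl i h1 h2)
  rw [re] at e1
  rw [sq_zpow, abs_le]; constructor <;> linarith

def Sh' (f : Equiv.Perm ℝ) (x : ℝ) : Prop :=
  ∀ ε : ℝ, 0 < ε → ∃ δ : ℝ, 0 < δ ∧ ∀ ρ : ℤ → ℝ, ρ 0 = x → PO f δ ρ →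
    ∃ y, ∀ i, |(f ^ i) y - ρ i| ≤ ε

lemma sh_inc {f : Equiv.Perm ℝ} {x : ℝ} (hf : IsUniformEquiv f) (hm : StrictMono f)
    (hP : IsAlphaPersistentPt f x) : Sh' f x := by
  intro ε hε
  obtain ⟨δ, hδ, H⟩ := Inc (S := Set.univ) ⟨hm, hf.1, hf.2, Set.ordConnected_univ, by simp⟩
    (mon_inc hf hm hP) (Set.mem_univ _) hε
  exact ⟨δ, hδ, fun ρ h0 h => H ρ h0 (by simp) h⟩

lemma disc_ivt {P : ℤ → Prop} {m n : ℤ} (hmn : m < n) (hm : P m) (hn : ¬ P n) :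
    ∃ k, m ≤ k ∧ k < n ∧ P k ∧ ¬ P (k + 1) := by
  revert hn
  induction n, hmn using Int.leInduction with
  | base => intro hn; exact ⟨m, le_rfl, by omega, hm, hn⟩
  | succ n h ih =>
    intro hn
    by_cases hp : P n
    · exact ⟨n, by omega, by omega, hp, hn⟩
    · obtain ⟨k, h1, h2, h3⟩ := ih hp
      exact ⟨k, h1, by omega, h3⟩

lemma sh_dec {f : Equiv.Perm ℝ} {x c : ℝ} (hf : IsUniformEquiv f) (hm : StrictAnti f)
    (hc : f c = c) (hcx : c ≤ x) (hP : IsAlphaPersistentPt f x) : Sh' f x := by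
  intro ε hε
  have hM := mon_dec hf hm hc hP
  have hG : Good (f * f) (Set.Ici c) := by
    refine ⟨hm.comp hm, hf.1.comp hf.1, hf.2.comp hf.2, Set.ordConnected_Ici, fun p => ?_⟩
    change c ≤ f (f p) ↔ c ≤ p
    have h1 : c ≤ f (f p) ↔ f p ≤ c := by
      conv_lhs => rw [← hc]
      exact hm.le_iff_ge
    have h2 : f p ≤ c ↔ c ≤ p := by
      conv_lhs => rw [← hc]
      exact hm.le_iff_ge
    rw [h1, h2]
  -- constants
  obtain ⟨e1', he1', He1'⟩ := uc_le hf.1 (half_pos hε)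
  obtain ⟨e1, he1, h1a, h1b⟩ : ∃ e : ℝ, 0 < e ∧ e ≤ e1' ∧ e ≤ ε :=
    ⟨min e1' ε, lt_min he1' hε, min_le_left _ _, min_le_right _ _⟩
  obtain ⟨e0', he0', He0'⟩ := uc_le hf.2 he1
  obtain ⟨e0, he0, h0a, h0b⟩ : ∃ e : ℝ, 0 < e ∧ e ≤ e0' ∧ e ≤ e1 :=
    ⟨min e0' e1, lt_min he0' he1, min_le_left _ _, min_le_right _ _⟩
  obtain ⟨κ', hκ', Hκ'⟩ := uc_le hf.1 (ε := e0 / 4) (by linarith)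
  obtain ⟨κ, hκ, hκa, hκb⟩ : ∃ e : ℝ, 0 < e ∧ e ≤ κ' ∧ e ≤ e0 / 4 :=
    ⟨min κ' (e0 / 4), lt_min hκ' (by linarith), min_le_left _ _, min_le_right _ _⟩
  have hfk : c < f (c - κ) := by
    conv_lhs => rw [← hc]
    exact hm (by linarith)
  obtain ⟨C, hC, hCa, hCb⟩ : ∃ C : ℝ, 0 < C ∧ c + 2 * C ≤ c + κ ∧ c + 2 * C ≤ f (c - κ) :=
    ⟨min (κ / 2) ((f (c - κ) - c) / 2), lt_min (by linarith) (by linarith),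
      by linarith [min_le_left (κ / 2) ((f (c - κ) - c) / 2)],
      by linarith [min_le_right (κ / 2) ((f (c - κ) - c) / 2)]⟩
  obtain ⟨d1, hd1, HK⟩ := KK hG hM hcx hC
  obtain ⟨d2, hd2, HI⟩ := Inc hG hM hcx (half_pos he0)
  have hd12 : 0 < min d1 d2 := lt_min hd1 hd2
  obtain ⟨d3, hd3, H3⟩ := uc_le hf.1 hd12
  obtain ⟨d4, hd4, H4⟩ := uc_le hf.1 hC
  obtain ⟨dF, hdF, hFa, hFb, hFc, hFd⟩ : ∃ e : ℝ, 0 < e ∧ e ≤ min d1 d2 ∧ e ≤ d3 ∧ e ≤ d4 ∧ e ≤ C :=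
    ⟨min (min d1 d2) (min d3 (min d4 C)), lt_min hd12 (lt_min hd3 (lt_min hd4 hC)),
      min_le_left _ _, (min_le_right _ _).trans (min_le_left _ _),
      (min_le_right _ _).trans ((min_le_right _ _).trans (min_le_left _ _)),
      (min_le_right _ _).trans ((min_le_right _ _).trans (min_le_right _ _))⟩
  obtain ⟨d5, hd5, H5⟩ := uc_le hf.1 (half_pos hdF)
  obtain ⟨δ, hδ, hδa, hδb, hδc⟩ : ∃ e : ℝ, 0 < e ∧ e ≤ dF / 2 ∧ e ≤ d5 ∧ e ≤ ε / 2 :=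
    ⟨min (dF / 2) (min d5 (ε / 2)), lt_min (by linarith) (lt_min hd5 (by linarith)),
      min_le_left _ _, (min_le_right _ _).trans (min_le_left _ _),
      (min_le_right _ _).trans (min_le_right _ _)⟩
  refine ⟨δ, hδ, fun ρ ρ0 hρ => ?_⟩
  set u : ℤ → ℝ := fun i => ρ (2 * i) with hu
  have huP : ∀ i, |f (f (u i)) - u (i + 1)| ≤ dF := by
    intro i
    have a1 := abs_le.1 (H5 _ _ ((hρ (2 * i)).trans hδb))
    have a2 := abs_le.1 (hρ (2 * i + 1))
    have a3 : u (i + 1) = ρ (2 * i + 1 + 1) := by simp only [hu]; congr 1; ring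
    rw [a3, abs_le]
    constructor <;> linarith
  -- reduction to tracing `u`
  suffices hsuff : ∃ y, ∀ i, |((f * f) ^ i) y - u i| ≤ e1 by
    obtain ⟨y, hy⟩ := hsuff
    refine ⟨y, fun i => ?_⟩
    obtain ⟨k, rfl | rfl⟩ := Int.even_or_odd' i
    · have := hy k
      rw [sq_zpow] at this
      exact this.trans h1b
    · have a1 := hy k
      rw [sq_zpow] at a1
      have a2 := abs_le.1 (He1' _ _ (a1.trans h1a))
      have a3 := abs_le.1 (hρ (2 * k))
      rw [zpow_succ_apply, abs_le]
      simp only [hu] at a2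
      constructor <;> linarith
  have hle : ∀ {t}, t ≤ c → c ≤ f t := fun {t} h => by
    have := hm.antitone h; rwa [hc] at this
  have hge : ∀ {t}, c ≤ t → f t ≤ c := fun {t} h => by
    have := hm.antitone h; rwa [hc] at this
  set U : ℤ → ℝ := fun i => max (u i) (f (u i)) with hU
  have U1 : ∀ i, c ≤ u i → U i = u i := fun i h => max_eq_left ((hge h).trans h)
  have U2 : ∀ i, u i ≤ c → U i = f (u i) := fun i h => max_eq_right (h.trans (hle h))
  have hUS : ∀ i, U i ∈ Set.Ici c := fun i => by
    rcases le_total c (u i) with h | h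
    · exact h.trans (le_max_left _ _)
    · exact (hle h).trans (le_max_right _ _)
  have hu0 : u 0 = x := by simp [hu, ρ0]
  have hU0 : U 0 = x := by rw [U1 0 (by rw [hu0]; exact hcx), hu0]
  have hUP : PO (f * f) (min d1 d2) U := by
    intro i
    have a1 : (f * f) (U i) = max (f (f (u i))) (f (f (f (u i)))) := hG.mono.monotone.map_max
    rw [a1]
    refine (abs_max_sub_max_le_max _ _ _ _).trans (max_le ?_ ?_)
    · exact (huP i).trans hFa
    · exact H3 _ _ ((huP i).trans hFb)
  -- both sides impossible
  have hside : ∀ m n, u m < c - κ → c + κ < u n → False := by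
    intro m n h1 h2
    have b1 : c + 2 * C ≤ U m := by
      rw [U2 m (by linarith)]
      have := hm h1
      linarith
    have b2 : c + 2 * C ≤ U n := by
      rw [U1 n (by linarith)]; linarith
    have HK' := HK U hU0 hUS (hUP.mono (min_le_left _ _)) (c + C) (c + 2 * C) (by linarith)
    rcases lt_trichotomy m n with h | h | h
    · obtain ⟨k, k1, k2, k3, k4⟩ := disc_ivt (P := fun i => u i < c) h (by linarith)
        (not_lt.2 (by linarith))
      push Not at k4
      have k5 : f (f (u k)) ≤ c := hge (hle k3.le)
      have k6 := abs_le.1 (huP k)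
      have k7 : U (k + 1) ≤ c + C := by rw [U1 _ k4]; linarith
      have k8 : k + 1 ≠ n := fun e => by rw [e] at k7; linarith
      exact HK' (k + 1) n m (k + 1) (by omega) k7 b2 (by omega) b1 k7
    · subst h; linarith
    · obtain ⟨k, k1, k2, k3, k4⟩ := disc_ivt (P := fun i => c ≤ u i) h (by linarith)
        (not_le.2 (by linarith))
      push Not at k4
      have k5 : c ≤ f (f (u k)) := hle (hge k3)
      have k6 := abs_le.1 (huP k)
      have k7 : U (k + 1) ≤ c + C := by
        rw [U2 _ k4.le]
        have := abs_le.1 (H4 (u (k + 1)) c (by rw [abs_le]; constructor <;> linarith))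
        linarith
      have k8 : k + 1 ≠ m := fun e => by rw [e] at k7; linarith
      exact HK' (k + 1) m n (k + 1) (by omega) k7 b1 (by omega) b2 k7
  obtain ⟨y, hy⟩ := HI U hU0 hUS (hUP.mono (min_le_right _ _))
  have hnear : ∀ t, |t - c| ≤ κ → |f t - c| ≤ e0 / 4 := fun t ht => by
    have := Hκ' t c (ht.trans hκa); rwa [hc] at this
  by_cases hall : ∀ i, c - κ ≤ u i
  · refine ⟨y, fun i => ?_⟩
    have a1 := abs_le.1 (hy i)
    rcases le_total c (u i) with h | h
    · rw [U1 i h] at a1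
      rw [abs_le]; constructor <;> linarith
    · have a2 := hall i
      have a3 := abs_le.1 (hnear (u i) (by rw [abs_le]; constructor <;> linarith))
      rw [U2 i h] at a1
      rw [abs_le]; constructor <;> linarith
  · push Not at hall
    obtain ⟨m, hm'⟩ := hall
    have hall2 : ∀ i, u i ≤ c + κ := fun i => by
      by_contra hcon
      exact hside m i hm' (not_le.1 hcon)
    refine ⟨f.symm y, fun i => ?_⟩
    have hcomm : ((f * f) ^ i) (f.symm y) = f.symm (((f * f) ^ i) y) := by
      apply f.injective
      rw [Equiv.apply_symm_apply, sq_zpow, ← zpow_succ_apply, zpow_succ_apply',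
        Equiv.apply_symm_apply]
    have a0 : |((f * f) ^ i) y - f (u i)| ≤ e0 := by
      have a1 := abs_le.1 (hy i)
      rcases le_total c (u i) with h | h
      · have a2 := hall2 i
        have a3 := abs_le.1 (hnear (u i) (by rw [abs_le]; constructor <;> linarith))
        rw [U1 i h] at a1
        rw [abs_le]; constructor <;> linarith
      · rw [U2 i h] at a1
        rw [abs_le]; constructor <;> linarith
    have a4 := He0' _ _ (a0.trans h0a)
    rw [Equiv.symm_apply_apply] at a4
    rw [hcomm]
    exact a4

lemma mir_mir (f : Equiv.Perm ℝ) : mir (mir f) = f := by ext t; simp [mir_apply]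

lemma ue_mirror {f : Equiv.Perm ℝ} (hf : IsUniformEquiv f) : IsUniformEquiv (mir f) :=
  ⟨uc_neg hf.1, uc_neg hf.2⟩

lemma C0_mirror (f g : Equiv.Perm ℝ) : C0Dist f (mir g) = C0Dist (mir f) g := by
  unfold C0Dist
  apply (Equiv.neg ℝ).iSup_congr
  intro t
  simp only [Equiv.neg_apply, mir_apply, neg_neg]
  rw [← dist_neg_neg, neg_neg]

lemma P_mirror {f : Equiv.Perm ℝ} {x : ℝ} (h : IsAlphaPersistentPt f x) :
    IsAlphaPersistentPt (mir f) (-x) := by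
  intro ε hε
  obtain ⟨δ, hδ, H⟩ := h ε hε
  refine ⟨δ, hδ, fun g hg hd => ?_⟩
  obtain ⟨y, hy⟩ := H (mir g) (ue_mirror hg) (by rw [C0_mirror]; exact hd)
  refine ⟨-y, fun n => ?_⟩
  have := hy n
  rw [mir_zpow] at this ⊢
  rwa [neg_neg, ← dist_neg_neg, neg_neg]

lemma Sh_mirror {f : Equiv.Perm ℝ} {x : ℝ} (h : Sh' (mir f) (-x)) : Sh' f x := by
  intro ε hε
  obtain ⟨δ, hδ, H⟩ := h ε hε
  refine ⟨δ, hδ, fun ρ h0 hρ => ?_⟩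
  obtain ⟨y, hy⟩ := H (fun i => - ρ i) (by simp [h0]) hρ.mirror
  refine ⟨-y, fun i => ?_⟩
  have := hy i
  rw [mir_zpow, ← abs_neg] at this
  convert this using 2
  ring

lemma exists_fix {f : Equiv.Perm ℝ} (hf : IsUniformEquiv f) (hm : StrictAnti f) :
    ∃ c, f c = c := by
  have hcont : Continuous fun t => t - f t := continuous_id.sub hf.1.continuous
  have hs : Function.Surjective fun t => t - f t := by
    apply hcont.surjective
    · apply Filter.tendsto_atTop_mono' (f₁ := fun t => t + -f 0)
      · filter_upwards [Filter.eventually_ge_atTop 0] with t ht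
        have := hm.antitone ht
        linarith
      · exact Filter.tendsto_atTop_add_const_right _ _ Filter.tendsto_id
    · refine Filter.tendsto_atBot_mono' _
        (?_ : (fun t => t - f t) ≤ᶠ[Filter.atBot] fun t => t + -f 0) ?_
      · filter_upwards [Filter.eventually_le_atBot 0] with t ht
        have := hm.antitone ht
        linarith
      · exact Filter.tendsto_atBot_add_const_right _ _ Filter.tendsto_id
  obtain ⟨c, h⟩ := hs 0
  exact ⟨c, by simp only at h; linarith⟩

lemma sh_all {f : Equiv.Perm ℝ} {x : ℝ} (hf : IsUniformEquiv f)
    (hP : IsAlphaPersistentPt f x) : Sh' f x := by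
  rcases hf.1.continuous.strictMono_of_inj f.injective with hm | hm
  · exact sh_inc hf hm hP
  · obtain ⟨c, hc⟩ := exists_fix hf hm
    rcases le_total c x with h | h
    · exact sh_dec hf hm hc h hP
    · apply Sh_mirror
      refine sh_dec (c := -c) (ue_mirror hf) ?_ ?_ (by linarith) (P_mirror hP)
      · intro a b hab
        rw [mir_apply, mir_apply]
        exact neg_lt_neg (hm (neg_lt_neg hab))
      · rw [mir_apply, neg_neg, hc]

end WtsAux

/-- For every uniform equivalence `f` of `ℝ` (with the Euclidean metric),
`Wts(f) ⊆ Sh(f) ⊆ P_α(f)`. -/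
theorem wts_subset_sh_subset_palpha
    (f : Equiv.Perm ℝ) (hf : IsUniformEquiv f) :
    (∀ x : ℝ, IsWeakTopStablePt f x → IsShadowablePt f x) ∧
    (∀ x : ℝ, IsShadowablePt f x → IsAlphaPersistentPt f x) := by
  constructor
  · intro x hx
    have hP : IsAlphaPersistentPt f x := by
      intro ε hε
      obtain ⟨δ, hδ, H⟩ := hx ε hε
      refine ⟨δ, hδ, fun g hg hd => ?_⟩
      obtain ⟨h, -, h1, -⟩ := H g hg hd
      exact ⟨_, fun n => h1 ⟨x, subset_closure ⟨0, by simp⟩⟩ n⟩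
    intro ε hε
    obtain ⟨δ, hδ, H⟩ := WtsAux.sh_all hf hP (ε / 2) (by linarith)
    refine ⟨δ, hδ, fun ρ h0 hρ => ?_⟩
    obtain ⟨y, hy⟩ := H ρ h0 (fun i => by have := hρ i; rw [Real.dist_eq] at this; exact this.le)
    refine ⟨y, fun i => ?_⟩
    rw [Real.dist_eq]
    linarith [hy i]
  · intro x hx ε hε
    obtain ⟨δ, hδ, H⟩ := hx ε hε
    refine ⟨min δ 1, lt_min hδ one_pos, fun g hg hd => ?_⟩
    apply H (fun i => (g ^ i) x) (by simp)
    intro i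
    rw [WtsAux.zpow_succ_apply]
    have hb : BddAbove (Set.range fun t => min (dist (f t) (g t)) 1) :=
      ⟨1, by rintro _ ⟨t, rfl⟩; exact min_le_right _ _⟩
    have h1 : min (dist (f ((g ^ i) x)) (g ((g ^ i) x))) 1 ≤ C0Dist f g :=
      le_ciSup hb ((g ^ i) x)
    have h2 := h1.trans_lt hd
    rcases min_lt_iff.1 h2 with h3 | h3
    · exact h3.trans_le (min_le_left _ _)
    · exact absurd (h3.trans_le (min_le_right _ _)) (lt_irrefl _)
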